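/- Let P be a projective plane of order n ≥ 5 and A, B, C three non-collinear points. In the structure obtained by deleting all points on lines AB, AC, BC and all lines through A, B, C, any two remaining points that are not collinear in the remaining structure have exactly (n-3)(n-4) remaining points collinear with both. -/

import Mathlib

/-- Removing from the points satisfying `p` those on a line `l` of `k` points, where the points
of `l` violating `p` are those of `T`. -/
theorem card_filter_and_not_inc {Pt Ln : Type*} [Fintype Pt] [DecidableEq Pt]
    (Inc : Pt → Ln → Prop) [∀ p l, Decidable (Inc p l)] {k : ℕ} (p : Pt → Prop) [DecidablePred p]
    (l : Ln) (hl : (Finset.univ.filter (fun z : Pt => Inc z l)).card = k)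
    (T : Finset Pt) (hT : ∀ z, z ∈ T ↔ Inc z l ∧ ¬ p z) :
    (Finset.univ.filter (fun z : Pt => p z ∧ ¬ Inc z l)).card + k
      = (Finset.univ.filter p).card + T.card := by
  have hTeq : T = (Finset.univ.filter (fun z : Pt => Inc z l)).filter (fun z => ¬ p z) := by
    ext z; simp [hT]
  have h₁ := Finset.card_filter_add_card_filter_not
    (s := Finset.univ.filter (fun z : Pt => Inc z l)) p
  have h₂ := Finset.card_filter_add_card_filter_not
    (s := Finset.univ.filter p) (fun z : Pt => Inc z l)
  rw [← hTeq] at h₁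
  simp only [Finset.filter_filter] at h₁ h₂
  simp only [and_comm (a := Inc _ l)] at h₁
  omega

set_option maxHeartbeats 1000000 in
/-- The number of points off the sides of a triangle `ABC` and off the lines joining its vertices
to two points `P`, `Q` that are off the sides and lie on a common line through `A`. -/
theorem card_off_triangle_and_joins {Pt Ln : Type*} [Fintype Pt] [DecidableEq Pt]
    (Inc : Pt → Ln → Prop) [∀ p l, Decidable (Inc p l)] (n : ℕ) (hn : 4 ≤ n)
    (hline : ∀ p q : Pt, ∀ l m : Ln, Inc p l → Inc q l → Inc p m → Inc q m → p = q ∨ l = m)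
    (hmeet : ∀ l m : Ln, l ≠ m → ∃ p : Pt, Inc p l ∧ Inc p m)
    (hldeg : ∀ l : Ln, (Finset.univ.filter (fun p : Pt => Inc p l)).card = n + 1)
    (hcardP : Fintype.card Pt = n ^ 2 + n + 1)
    (A B C P Q : Pt) (lAB lAC lBC a pb pc qb qc : Ln)
    (hAB : Inc A lAB ∧ Inc B lAB ∧ ¬ Inc C lAB) (hAC : Inc A lAC ∧ Inc C lAC ∧ ¬ Inc B lAC)
    (hBC : Inc B lBC ∧ Inc C lBC ∧ ¬ Inc A lBC)
    (hPQ : P ≠ Q)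
    (hP : ¬ Inc P lAB ∧ ¬ Inc P lAC ∧ ¬ Inc P lBC)
    (hQ : ¬ Inc Q lAB ∧ ¬ Inc Q lAC ∧ ¬ Inc Q lBC)
    (ha : Inc A a ∧ Inc P a ∧ Inc Q a)
    (hpb : Inc P pb ∧ Inc B pb) (hpc : Inc P pc ∧ Inc C pc)
    (hqb : Inc Q qb ∧ Inc B qb) (hqc : Inc Q qc ∧ Inc C qc) :
    (Finset.univ.filter (fun z : Pt => (((((((¬ Inc z a ∧ ¬ Inc z pb) ∧ ¬ Inc z pc) ∧ ¬ Inc z qb)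
        ∧ ¬ Inc z qc) ∧ ¬ Inc z lAB) ∧ ¬ Inc z lAC) ∧ ¬ Inc z lBC))).card
      = (n - 3) * (n - 4) := by
  obtain ⟨A_AB, B_AB, C_AB⟩ := hAB
  obtain ⟨A_AC, C_AC, B_AC⟩ := hAC
  obtain ⟨B_BC, C_BC, A_BC⟩ := hBC
  obtain ⟨P_AB, P_AC, P_BC⟩ := hP
  obtain ⟨Q_AB, Q_AC, Q_BC⟩ := hQ
  obtain ⟨A_a, P_a, Q_a⟩ := ha
  obtain ⟨P_pb, B_pb⟩ := hpb
  obtain ⟨P_pc, C_pc⟩ := hpc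
  obtain ⟨Q_qb, B_qb⟩ := hqb
  obtain ⟨Q_qc, C_qc⟩ := hqc
  have hnAB : A ≠ B := by grind
  have hnAC : A ≠ C := by grind
  have hnBC : B ≠ C := by grind
  have B_a : ¬ Inc B a := by grind [hline B A a lAB]
  have C_a : ¬ Inc C a := by grind [hline C A a lAC]
  have A_pb : ¬ Inc A pb := by grind [hline A B pb lAB]
  have C_pb : ¬ Inc C pb := by grind [hline C B pb lBC]
  have Q_pb : ¬ Inc Q pb := by grind [hline Q P pb a]
  have A_pc : ¬ Inc A pc := by grind [hline A C pc lAC]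
  have B_pc : ¬ Inc B pc := by grind [hline B C pc lBC]
  have Q_pc : ¬ Inc Q pc := by grind [hline Q P pc a]
  have A_qb : ¬ Inc A qb := by grind [hline A B qb lAB]
  have C_qb : ¬ Inc C qb := by grind [hline C B qb lBC]
  have P_qb : ¬ Inc P qb := by grind [hline P B qb pb]
  have A_qc : ¬ Inc A qc := by grind [hline A C qc lAC]
  have B_qc : ¬ Inc B qc := by grind [hline B C qc lBC]
  have P_qc : ¬ Inc P qc := by grind [hline P C qc pc]
  have ne_a_pb : a ≠ pb := by rintro rfl; contradiction
  have eq_a_pb : ∀ z, Inc z a → Inc z pb → z = P := fun z h₁ h₂ =>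
    (hline z P a pb h₁ P_a h₂ P_pb).resolve_right ne_a_pb
  have ne_a_pc : a ≠ pc := by rintro rfl; contradiction
  have eq_a_pc : ∀ z, Inc z a → Inc z pc → z = P := fun z h₁ h₂ =>
    (hline z P a pc h₁ P_a h₂ P_pc).resolve_right ne_a_pc
  have ne_pb_pc : pb ≠ pc := by rintro rfl; contradiction
  have eq_pb_pc : ∀ z, Inc z pb → Inc z pc → z = P := fun z h₁ h₂ =>
    (hline z P pb pc h₁ P_pb h₂ P_pc).resolve_right ne_pb_pc
  have ne_a_qb : a ≠ qb := by rintro rfl; contradiction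
  have eq_a_qb : ∀ z, Inc z a → Inc z qb → z = Q := fun z h₁ h₂ =>
    (hline z Q a qb h₁ Q_a h₂ Q_qb).resolve_right ne_a_qb
  have ne_pb_qb : pb ≠ qb := by rintro rfl; contradiction
  have eq_pb_qb : ∀ z, Inc z pb → Inc z qb → z = B := fun z h₁ h₂ =>
    (hline z B pb qb h₁ B_pb h₂ B_qb).resolve_right ne_pb_qb
  have ne_pc_qb : pc ≠ qb := by rintro rfl; contradiction
  obtain ⟨X, X_pc, X_qb⟩ := hmeet pc qb ne_pc_qb
  have eq_pc_qb : ∀ z, Inc z pc → Inc z qb → z = X := fun z h₁ h₂ =>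
    (hline z X pc qb h₁ X_pc h₂ X_qb).resolve_right ne_pc_qb
  have ne_a_qc : a ≠ qc := by rintro rfl; contradiction
  have eq_a_qc : ∀ z, Inc z a → Inc z qc → z = Q := fun z h₁ h₂ =>
    (hline z Q a qc h₁ Q_a h₂ Q_qc).resolve_right ne_a_qc
  have ne_pb_qc : pb ≠ qc := by rintro rfl; contradiction
  obtain ⟨Y, Y_pb, Y_qc⟩ := hmeet pb qc ne_pb_qc
  have eq_pb_qc : ∀ z, Inc z pb → Inc z qc → z = Y := fun z h₁ h₂ =>
    (hline z Y pb qc h₁ Y_pb h₂ Y_qc).resolve_right ne_pb_qc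
  have ne_pc_qc : pc ≠ qc := by rintro rfl; contradiction
  have eq_pc_qc : ∀ z, Inc z pc → Inc z qc → z = C := fun z h₁ h₂ =>
    (hline z C pc qc h₁ C_pc h₂ C_qc).resolve_right ne_pc_qc
  have ne_qb_qc : qb ≠ qc := by rintro rfl; contradiction
  have eq_qb_qc : ∀ z, Inc z qb → Inc z qc → z = Q := fun z h₁ h₂ =>
    (hline z Q qb qc h₁ Q_qb h₂ Q_qc).resolve_right ne_qb_qc
  have ne_a_AB : a ≠ lAB := by rintro rfl; contradiction
  have eq_a_AB : ∀ z, Inc z a → Inc z lAB → z = A := fun z h₁ h₂ =>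
    (hline z A a lAB h₁ A_a h₂ A_AB).resolve_right ne_a_AB
  have ne_pb_AB : pb ≠ lAB := by rintro rfl; contradiction
  have eq_pb_AB : ∀ z, Inc z pb → Inc z lAB → z = B := fun z h₁ h₂ =>
    (hline z B pb lAB h₁ B_pb h₂ B_AB).resolve_right ne_pb_AB
  have ne_pc_AB : pc ≠ lAB := by rintro rfl; contradiction
  obtain ⟨Z, Z_pc, Z_AB⟩ := hmeet pc lAB ne_pc_AB
  have eq_pc_AB : ∀ z, Inc z pc → Inc z lAB → z = Z := fun z h₁ h₂ =>
    (hline z Z pc lAB h₁ Z_pc h₂ Z_AB).resolve_right ne_pc_AB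
  have ne_qb_AB : qb ≠ lAB := by rintro rfl; contradiction
  have eq_qb_AB : ∀ z, Inc z qb → Inc z lAB → z = B := fun z h₁ h₂ =>
    (hline z B qb lAB h₁ B_qb h₂ B_AB).resolve_right ne_qb_AB
  have ne_qc_AB : qc ≠ lAB := by rintro rfl; contradiction
  obtain ⟨U, U_qc, U_AB⟩ := hmeet qc lAB ne_qc_AB
  have eq_qc_AB : ∀ z, Inc z qc → Inc z lAB → z = U := fun z h₁ h₂ =>
    (hline z U qc lAB h₁ U_qc h₂ U_AB).resolve_right ne_qc_AB
  have ne_a_AC : a ≠ lAC := by rintro rfl; contradiction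
  have eq_a_AC : ∀ z, Inc z a → Inc z lAC → z = A := fun z h₁ h₂ =>
    (hline z A a lAC h₁ A_a h₂ A_AC).resolve_right ne_a_AC
  have ne_pb_AC : pb ≠ lAC := by rintro rfl; contradiction
  obtain ⟨V, V_pb, V_AC⟩ := hmeet pb lAC ne_pb_AC
  have eq_pb_AC : ∀ z, Inc z pb → Inc z lAC → z = V := fun z h₁ h₂ =>
    (hline z V pb lAC h₁ V_pb h₂ V_AC).resolve_right ne_pb_AC
  have ne_pc_AC : pc ≠ lAC := by rintro rfl; contradiction
  have eq_pc_AC : ∀ z, Inc z pc → Inc z lAC → z = C := fun z h₁ h₂ =>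
    (hline z C pc lAC h₁ C_pc h₂ C_AC).resolve_right ne_pc_AC
  have ne_qb_AC : qb ≠ lAC := by rintro rfl; contradiction
  obtain ⟨W, W_qb, W_AC⟩ := hmeet qb lAC ne_qb_AC
  have eq_qb_AC : ∀ z, Inc z qb → Inc z lAC → z = W := fun z h₁ h₂ =>
    (hline z W qb lAC h₁ W_qb h₂ W_AC).resolve_right ne_qb_AC
  have ne_qc_AC : qc ≠ lAC := by rintro rfl; contradiction
  have eq_qc_AC : ∀ z, Inc z qc → Inc z lAC → z = C := fun z h₁ h₂ =>
    (hline z C qc lAC h₁ C_qc h₂ C_AC).resolve_right ne_qc_AC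
  have ne_AB_AC : lAB ≠ lAC := by rintro rfl; contradiction
  have eq_AB_AC : ∀ z, Inc z lAB → Inc z lAC → z = A := fun z h₁ h₂ =>
    (hline z A lAB lAC h₁ A_AB h₂ A_AC).resolve_right ne_AB_AC
  have ne_a_BC : a ≠ lBC := by rintro rfl; contradiction
  obtain ⟨S, S_a, S_BC⟩ := hmeet a lBC ne_a_BC
  have eq_a_BC : ∀ z, Inc z a → Inc z lBC → z = S := fun z h₁ h₂ =>
    (hline z S a lBC h₁ S_a h₂ S_BC).resolve_right ne_a_BC
  have ne_pb_BC : pb ≠ lBC := by rintro rfl; contradiction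
  have eq_pb_BC : ∀ z, Inc z pb → Inc z lBC → z = B := fun z h₁ h₂ =>
    (hline z B pb lBC h₁ B_pb h₂ B_BC).resolve_right ne_pb_BC
  have ne_pc_BC : pc ≠ lBC := by rintro rfl; contradiction
  have eq_pc_BC : ∀ z, Inc z pc → Inc z lBC → z = C := fun z h₁ h₂ =>
    (hline z C pc lBC h₁ C_pc h₂ C_BC).resolve_right ne_pc_BC
  have ne_qb_BC : qb ≠ lBC := by rintro rfl; contradiction
  have eq_qb_BC : ∀ z, Inc z qb → Inc z lBC → z = B := fun z h₁ h₂ =>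
    (hline z B qb lBC h₁ B_qb h₂ B_BC).resolve_right ne_qb_BC
  have ne_qc_BC : qc ≠ lBC := by rintro rfl; contradiction
  have eq_qc_BC : ∀ z, Inc z qc → Inc z lBC → z = C := fun z h₁ h₂ =>
    (hline z C qc lBC h₁ C_qc h₂ C_BC).resolve_right ne_qc_BC
  have ne_AB_BC : lAB ≠ lBC := by rintro rfl; contradiction
  have eq_AB_BC : ∀ z, Inc z lAB → Inc z lBC → z = B := fun z h₁ h₂ =>
    (hline z B lAB lBC h₁ B_AB h₂ B_BC).resolve_right ne_AB_BC
  have ne_AC_BC : lAC ≠ lBC := by rintro rfl; contradiction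
  have eq_AC_BC : ∀ z, Inc z lAC → Inc z lBC → z = C := fun z h₁ h₂ =>
    (hline z C lAC lBC h₁ C_AC h₂ C_BC).resolve_right ne_AC_BC
  have c_a : (Finset.univ.filter (fun z : Pt => ¬ Inc z a)).card + (n + 1) = n ^ 2 + n + 1 := by
    have h := Finset.card_filter_add_card_filter_not (s := Finset.univ) (fun z : Pt => Inc z a)
    rw [hldeg, Finset.card_univ, hcardP] at h
    omega
  have c_pb := card_filter_and_not_inc Inc
    (fun z => ¬ Inc z a)
    pb (hldeg pb) {P} (fun z => by simp only [Finset.mem_singleton]; grind)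
  have c_pc := card_filter_and_not_inc Inc
    (fun z => ¬ Inc z a ∧ ¬ Inc z pb)
    pc (hldeg pc) {P} (fun z => by simp only [Finset.mem_singleton]; grind)
  have hnQB : Q ≠ B := fun h => B_a (h ▸ Q_a)
  have hnQX : Q ≠ X := fun h => Q_pc (h ▸ X_pc)
  have hnBX : B ≠ X := fun h => B_pc (h ▸ X_pc)
  have t_qb : ({Q, B, X} : Finset Pt).card = 3 := by simp [hnQB, hnQX, hnBX]
  have c_qb := card_filter_and_not_inc Inc
    (fun z => (¬ Inc z a ∧ ¬ Inc z pb) ∧ ¬ Inc z pc)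
    qb (hldeg qb) {Q, B, X} (fun z => by
      simp only [Finset.mem_insert, Finset.mem_singleton]; grind)
  have hnQY : Q ≠ Y := fun h => Q_pb (h ▸ Y_pb)
  have hnQC : Q ≠ C := fun h => C_a (h ▸ Q_a)
  have hnYC : Y ≠ C := fun h => C_pb (h ▸ Y_pb)
  have t_qc : ({Q, Y, C} : Finset Pt).card = 3 := by simp [hnQY, hnQC, hnYC]
  have c_qc := card_filter_and_not_inc Inc
    (fun z => ((¬ Inc z a ∧ ¬ Inc z pb) ∧ ¬ Inc z pc) ∧ ¬ Inc z qb)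
    qc (hldeg qc) {Q, Y, C} (fun z => by
      simp only [Finset.mem_insert, Finset.mem_singleton]; grind)
  have hnAZ : A ≠ Z := fun h => A_pc (h ▸ Z_pc)
  have hnAU : A ≠ U := fun h => A_qc (h ▸ U_qc)
  have hnBZ : B ≠ Z := fun h => B_pc (h ▸ Z_pc)
  have hnBU : B ≠ U := fun h => B_qc (h ▸ U_qc)
  have hnZU : Z ≠ U := fun h => C_AB (eq_pc_qc Z Z_pc (h ▸ U_qc) ▸ Z_AB)
  have t_AB : ({A, B, Z, U} : Finset Pt).card = 4 := by simp [hnAB, hnAZ, hnAU, hnBZ, hnBU, hnZU]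
  have c_AB := card_filter_and_not_inc Inc
    (fun z => (((¬ Inc z a ∧ ¬ Inc z pb) ∧ ¬ Inc z pc) ∧ ¬ Inc z qb) ∧ ¬ Inc z qc)
    lAB (hldeg lAB) {A, B, Z, U} (fun z => by
      simp only [Finset.mem_insert, Finset.mem_singleton]; grind)
  have hnAV : A ≠ V := fun h => A_pb (h ▸ V_pb)
  have hnAW : A ≠ W := fun h => A_qb (h ▸ W_qb)
  have hnVC : V ≠ C := fun h => C_pb (h ▸ V_pb)
  have hnVW : V ≠ W := fun h => B_AC (eq_pb_qb V V_pb (h ▸ W_qb) ▸ V_AC)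
  have hnCW : C ≠ W := fun h => C_qb (h ▸ W_qb)
  have t_AC : ({A, V, C, W} : Finset Pt).card = 4 := by simp [hnAV, hnAC, hnAW, hnVC, hnVW, hnCW]
  have c_AC := card_filter_and_not_inc Inc
    (fun z => ((((¬ Inc z a ∧ ¬ Inc z pb) ∧ ¬ Inc z pc) ∧ ¬ Inc z qb) ∧ ¬ Inc z qc) ∧ ¬ Inc z lAB)
    lAC (hldeg lAC) {A, V, C, W} (fun z => by
      simp only [Finset.mem_insert, Finset.mem_singleton]; grind)
  have hnSB : S ≠ B := fun h => B_a (h ▸ S_a)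
  have hnSC : S ≠ C := fun h => C_a (h ▸ S_a)
  have t_BC : ({S, B, C} : Finset Pt).card = 3 := by simp [hnSB, hnSC, hnBC]
  have c_BC := card_filter_and_not_inc Inc
    (fun z => (((((¬ Inc z a ∧ ¬ Inc z pb) ∧ ¬ Inc z pc) ∧ ¬ Inc z qb) ∧ ¬ Inc z qc) ∧ ¬ Inc z lAB)
      ∧ ¬ Inc z lAC)
    lBC (hldeg lBC) {S, B, C} (fun z => by
      simp only [Finset.mem_insert, Finset.mem_singleton]; grind)
  rw [Finset.card_singleton] at c_pb
  rw [Finset.card_singleton] at c_pc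
  rw [t_qb] at c_qb
  rw [t_qc] at c_qc
  rw [t_AB] at c_AB
  rw [t_AC] at c_AC
  rw [t_BC] at c_BC
  obtain ⟨k, rfl⟩ := Nat.exists_eq_add_of_le hn
  rw [show 4 + k - 3 = k + 1 by omega, show 4 + k - 4 = k by omega]
  have h : (4 + k) ^ 2 = k * k + 8 * k + 16 := by ring
  rw [h] at c_a
  rw [add_mul, one_mul]
  omega

/-- If `a`, `b`, `c` join `P` to `A`, `B`, `C`, then the points joined to `P` by a line missing
`A`, `B`, `C` are those off `a`, `b`, `c`. -/
theorem exists_line_avoiding_iff {Pt Ln : Type*} (Inc : Pt → Ln → Prop)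
    (hjoin : ∀ p q : Pt, p ≠ q → ∃! l : Ln, Inc p l ∧ Inc q l)
    {A B C P z : Pt} {a b c : Ln} (hA : A ≠ P) (hB : B ≠ P) (hC : C ≠ P) (hz : z ≠ P)
    (ha : Inc P a ∧ Inc A a) (hb : Inc P b ∧ Inc B b) (hc : Inc P c ∧ Inc C c) :
    (∃ l : Ln, (¬ Inc A l ∧ ¬ Inc B l ∧ ¬ Inc C l) ∧ Inc P l ∧ Inc z l) ↔
      ¬ Inc z a ∧ ¬ Inc z b ∧ ¬ Inc z c := by
  have hu : ∀ p l m, p ≠ P → Inc p l → Inc P l → Inc p m → Inc P m → l = m :=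
    fun p l m hp h₁ h₂ h₃ h₄ => (hjoin p P hp).unique ⟨h₁, h₂⟩ ⟨h₃, h₄⟩
  constructor
  · rintro ⟨l, ⟨hAl, hBl, hCl⟩, hPl, hzl⟩
    refine ⟨fun h => hAl ?_, fun h => hBl ?_, fun h => hCl ?_⟩
    · exact hu z l a hz hzl hPl h ha.1 ▸ ha.2
    · exact hu z l b hz hzl hPl h hb.1 ▸ hb.2
    · exact hu z l c hz hzl hPl h hc.1 ▸ hc.2
  · rintro ⟨hza, hzb, hzc⟩
    obtain ⟨l, ⟨hzl, hPl⟩, -⟩ := hjoin z P hz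
    refine ⟨l, ⟨fun h => hza ?_, fun h => hzb ?_, fun h => hzc ?_⟩, hPl, hzl⟩
    · exact hu A l a hA h hPl ha.2 ha.1 ▸ hzl
    · exact hu B l b hB h hPl hb.2 hb.1 ▸ hzl
    · exact hu C l c hC h hPl hc.2 hc.1 ▸ hzl

/-- The count of common neighbours of two points off the sides of a triangle `ABC` that lie on
a common line through the vertex `A`. -/
theorem card_collinear_with_both_of_line_through_vertex {Pt Ln : Type*} [Fintype Pt] [Fintype Ln]
    [DecidableEq Pt] (Inc : Pt → Ln → Prop)
    [∀ p l, Decidable (Inc p l)] (n : ℕ) (hn : 4 ≤ n)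
    (hjoin : ∀ p q : Pt, p ≠ q → ∃! l : Ln, Inc p l ∧ Inc q l)
    (hmeet : ∀ l m : Ln, l ≠ m → ∃! p : Pt, Inc p l ∧ Inc p m)
    (hldeg : ∀ l : Ln, (Finset.univ.filter (fun p : Pt => Inc p l)).card = n + 1)
    (hcardP : Fintype.card Pt = n ^ 2 + n + 1)
    (A B C : Pt) (lAB lAC lBC a : Ln)
    (hAB : Inc A lAB ∧ Inc B lAB) (hAC : Inc A lAC ∧ Inc C lAC)
    (hBC : Inc B lBC ∧ Inc C lBC)
    (hnc : ¬ ∃ l : Ln, Inc A l ∧ Inc B l ∧ Inc C l)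
    (P Q : Pt) (hPQ : P ≠ Q)
    (hP : ¬ Inc P lAB ∧ ¬ Inc P lAC ∧ ¬ Inc P lBC)
    (hQ : ¬ Inc Q lAB ∧ ¬ Inc Q lAC ∧ ¬ Inc Q lBC)
    (ha : Inc A a ∧ Inc P a ∧ Inc Q a) :
    (Finset.univ.filter (fun z : Pt =>
        (¬ Inc z lAB ∧ ¬ Inc z lAC ∧ ¬ Inc z lBC) ∧ z ≠ P ∧ z ≠ Q ∧
        (∃ l : Ln, (¬ Inc A l ∧ ¬ Inc B l ∧ ¬ Inc C l) ∧ Inc P l ∧ Inc z l) ∧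
        (∃ l : Ln, (¬ Inc A l ∧ ¬ Inc B l ∧ ¬ Inc C l) ∧ Inc Q l ∧ Inc z l))).card
      = (n - 3) * (n - 4) := by
  have hAP : A ≠ P := fun h => hP.1 (h ▸ hAB.1)
  have hBP : B ≠ P := fun h => hP.1 (h ▸ hAB.2)
  have hCP : C ≠ P := fun h => hP.2.1 (h ▸ hAC.2)
  have hAQ : A ≠ Q := fun h => hQ.1 (h ▸ hAB.1)
  have hBQ : B ≠ Q := fun h => hQ.1 (h ▸ hAB.2)
  have hCQ : C ≠ Q := fun h => hQ.2.1 (h ▸ hAC.2)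
  obtain ⟨pb, hpb, -⟩ := hjoin P B hBP.symm
  obtain ⟨pc, hpc, -⟩ := hjoin P C hCP.symm
  obtain ⟨qb, hqb, -⟩ := hjoin Q B hBQ.symm
  obtain ⟨qc, hqc, -⟩ := hjoin Q C hCQ.symm
  have hline : ∀ p q : Pt, ∀ l m : Ln,
      Inc p l → Inc q l → Inc p m → Inc q m → p = q ∨ l = m := by
    intro p q l m h₁ h₂ h₃ h₄
    by_cases h : p = q
    · exact Or.inl h
    · exact Or.inr ((hjoin p q h).unique ⟨h₁, h₂⟩ ⟨h₃, h₄⟩)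
  rw [← card_off_triangle_and_joins Inc n hn hline (fun l m h => (hmeet l m h).exists) hldeg hcardP
    A B C P Q lAB lAC lBC a pb pc qb qc
    ⟨hAB.1, hAB.2, fun h => hnc ⟨lAB, hAB.1, hAB.2, h⟩⟩
    ⟨hAC.1, hAC.2, fun h => hnc ⟨lAC, hAC.1, h, hAC.2⟩⟩
    ⟨hBC.1, hBC.2, fun h => hnc ⟨lBC, h, hBC.1, hBC.2⟩⟩ hPQ hP hQ ha hpb hpc hqb hqc]
  congr 1
  ext z
  simp only [Finset.mem_filter, Finset.mem_univ, true_and]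
  by_cases hzP : z = P
  · subst hzP; simp [ha.2.1]
  by_cases hzQ : z = Q
  · subst hzQ; simp [ha.2.2]
  rw [exists_line_avoiding_iff Inc hjoin hAP hBP hCP hzP ⟨ha.2.1, ha.1⟩ hpb hpc,
    exists_line_avoiding_iff Inc hjoin hAQ hBQ hCQ hzQ ⟨ha.2.2, ha.1⟩ hqb hqc]
  tauto

/-- In the structure obtained from a projective plane of order `n ≥ 5` by deleting the
points of a triangle's sides and the lines through its vertices, any two remaining
non-collinear points have exactly `(n-3)(n-4)` remaining points collinear with both. -/
theorem stmt_10 {Pt Ln : Type*} [Fintype Pt] [Fintype Ln] [DecidableEq Pt] (Inc : Pt → Ln → Prop)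
    [∀ p l, Decidable (Inc p l)] (n : ℕ) (hn : 5 ≤ n)
    (hjoin : ∀ p q : Pt, p ≠ q → ∃! l : Ln, Inc p l ∧ Inc q l)
    (hmeet : ∀ l m : Ln, l ≠ m → ∃! p : Pt, Inc p l ∧ Inc p m)
    (hldeg : ∀ l : Ln, (Finset.univ.filter (fun p : Pt => Inc p l)).card = n + 1)
    (hpdeg : ∀ p : Pt, (Finset.univ.filter (fun l : Ln => Inc p l)).card = n + 1)
    (hcardP : Fintype.card Pt = n ^ 2 + n + 1)
    (hcardL : Fintype.card Ln = n ^ 2 + n + 1)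
    (A B C : Pt) (lAB lAC lBC : Ln)
    (hAB : Inc A lAB ∧ Inc B lAB) (hAC : Inc A lAC ∧ Inc C lAC)
    (hBC : Inc B lBC ∧ Inc C lBC)
    (hnc : ¬ ∃ l : Ln, Inc A l ∧ Inc B l ∧ Inc C l)
    (P Q : Pt) (hPQ : P ≠ Q)
    (hP : ¬ Inc P lAB ∧ ¬ Inc P lAC ∧ ¬ Inc P lBC)
    (hQ : ¬ Inc Q lAB ∧ ¬ Inc Q lAC ∧ ¬ Inc Q lBC)
    (hncoll : ¬ ∃ l : Ln, (¬ Inc A l ∧ ¬ Inc B l ∧ ¬ Inc C l) ∧ Inc P l ∧ Inc Q l) :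
    (Finset.univ.filter (fun z : Pt =>
        (¬ Inc z lAB ∧ ¬ Inc z lAC ∧ ¬ Inc z lBC) ∧ z ≠ P ∧ z ≠ Q ∧
        (∃ l : Ln, (¬ Inc A l ∧ ¬ Inc B l ∧ ¬ Inc C l) ∧ Inc P l ∧ Inc z l) ∧
        (∃ l : Ln, (¬ Inc A l ∧ ¬ Inc B l ∧ ¬ Inc C l) ∧ Inc Q l ∧ Inc z l))).card
      = (n - 3) * (n - 4) := by
  obtain ⟨a, ⟨hPa, hQa⟩, -⟩ := hjoin P Q hPQ
  have key := card_collinear_with_both_of_line_through_vertex Inc n (by omega) hjoin hmeet hldeg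
    hcardP
  by_cases hA : Inc A a
  · exact key A B C lAB lAC lBC a hAB hAC hBC hnc P Q hPQ hP hQ ⟨hA, hPa, hQa⟩
  by_cases hB : Inc B a
  · rw [← key B A C lAB lBC lAC a hAB.symm hBC hAC
      (by rintro ⟨l, h⟩; exact hnc ⟨l, by tauto⟩) P Q hPQ (by tauto) (by tauto) ⟨hB, hPa, hQa⟩]
    congr 1
    ext z
    simp only [Finset.mem_filter, Finset.mem_univ, true_and, and_comm, and_left_comm, and_assoc]
  by_cases hC : Inc C a
  · rw [← key C A B lAC lBC lAB a hAC.symm hBC.symm hAB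
      (by rintro ⟨l, h⟩; exact hnc ⟨l, by tauto⟩) P Q hPQ (by tauto) (by tauto) ⟨hC, hPa, hQa⟩]
    congr 1
    ext z
    simp only [Finset.mem_filter, Finset.mem_univ, true_and, and_comm, and_left_comm, and_assoc]
  exact (hncoll ⟨a, ⟨hA, hB, hC⟩, hPa, hQa⟩).elim
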